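/- arXiv:2601.19272 — 2 statements merged into one kernel-verified Lean document; each statement's English description precedes it below -/
import Mathlib

section
/- For every measurable function f on ℝⁿ and every x ∈ ℝⁿ, one has M f(x) ≤ ∫_0^1 m_λ f(x) dλ. -/
open MeasureTheory Set Filter
open scoped ENNReal Topology

noncomputable section

/-- A cube in `ℝⁿ` with sides parallel to the coordinate axes (positive side length). -/
def IsCube {n : ℕ} (Q : Set (Fin n → ℝ)) : Prop :=
  ∃ (a : Fin n → ℝ) (h : ℝ), 0 < h ∧ Q = Set.Icc a (fun i => a i + h)

/-- The Hardy–Littlewood maximal operator: `Mf(x) = sup_{Q ∋ x} (1/|Q|) ∫_Q f`. -/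
def maximal {n : ℕ} (f : (Fin n → ℝ) → ℝ≥0∞) (x : Fin n → ℝ) : ℝ≥0∞ :=
  ⨆ (Q : Set (Fin n → ℝ)) (_ : IsCube Q) (_ : x ∈ Q), (∫⁻ y in Q, f y) / volume Q

/-- The Hardy–Littlewood maximal operator restricted to a cube `Q`. -/
def maximalOn {n : ℕ} (Q : Set (Fin n → ℝ)) (f : (Fin n → ℝ) → ℝ≥0∞)
    (x : Fin n → ℝ) : ℝ≥0∞ :=
  ⨆ (R : Set (Fin n → ℝ)) (_ : IsCube R) (_ : R ⊆ Q) (_ : x ∈ R),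
    (∫⁻ y in R, f y) / volume R

/-- The non-increasing rearrangement `g*(t) = inf {α > 0 : |{y : g y > α}| ≤ t}`. -/
def rearr {n : ℕ} (g : (Fin n → ℝ) → ℝ≥0∞) (t : ℝ≥0∞) : ℝ≥0∞ :=
  sInf {α : ℝ≥0∞ | 0 < α ∧ volume {y | α < g y} ≤ t}

/-- The `λ`-median (local) maximal operator `m_λ f(x) = sup_{Q ∋ x} (f χ_Q)*(λ|Q|)`. -/
def mMed {n : ℕ} (la : ℝ) (f : (Fin n → ℝ) → ℝ≥0∞) (x : Fin n → ℝ) : ℝ≥0∞ :=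
  ⨆ (Q : Set (Fin n → ℝ)) (_ : IsCube Q) (_ : x ∈ Q),
    rearr (Q.indicator f) (ENNReal.ofReal la * volume Q)

/-- The (absolute value of a) real function viewed as an `ℝ≥0∞`-valued function. -/
def toE {n : ℕ} (f : (Fin n → ℝ) → ℝ) : (Fin n → ℝ) → ℝ≥0∞ :=
  fun y => ENNReal.ofReal |f y|

/-- `x` is a Lebesgue density point of the set `E`. -/
def IsDensityPoint {n : ℕ} (E : Set (Fin n → ℝ)) (x : Fin n → ℝ) : Prop :=
  Tendsto (fun r : ℝ => volume (E ∩ Metric.ball x r) / volume (Metric.ball x r))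
    (𝓝[>] (0 : ℝ)) (𝓝 1)

/-- `x` is a point of approximate continuity of `f`. -/
def ApproxContinuousAt {n : ℕ} (f : (Fin n → ℝ) → ℝ) (x : Fin n → ℝ) : Prop :=
  ∀ ε : ℝ, 0 < ε →
    Tendsto (fun r : ℝ =>
        volume ({y | ε ≤ |f y - f x|} ∩ Metric.ball x r) / volume (Metric.ball x r))
      (𝓝[>] (0 : ℝ)) (𝓝 0)

/-- A Banach function space over `ℝⁿ`, described by its (Luxemburg) function norm on
nonnegative extended-real-valued measurable functions. The ideal property is encoded by
`mono`, the Fatou property by `fatou`, and the saturation property by `saturation`. -/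
structure BanachFunctionSpace (n : ℕ) where
  N : ((Fin n → ℝ) → ℝ≥0∞) → ℝ≥0∞
  add_le : ∀ f g, N (fun x => f x + g x) ≤ N f + N g
  smul_eq : ∀ (c : ℝ≥0∞), c ≠ ∞ → ∀ f, N (fun x => c * f x) = c * N f
  mono : ∀ f g, (∀ᵐ x ∂(volume : Measure (Fin n → ℝ)), f x ≤ g x) → N f ≤ N g
  eq_zero : ∀ f, N f = 0 → f =ᵐ[(volume : Measure (Fin n → ℝ))] 0
  fatou : ∀ F : ℕ → ((Fin n → ℝ) → ℝ≥0∞),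
    (∀ j, ∀ᵐ x ∂(volume : Measure (Fin n → ℝ)), F j x ≤ F (j + 1) x) →
    N (fun x => ⨆ j, F j x) = ⨆ j, N (F j)
  saturation : ∀ E : Set (Fin n → ℝ), MeasurableSet E → 0 < volume E →
    ∃ F, F ⊆ E ∧ MeasurableSet F ∧ 0 < volume F ∧ N (F.indicator 1) ≠ ∞

/-- The associate (Köthe dual) norm of a function norm `N`:
`‖g‖_{X'} = sup_{‖h‖_X ≤ 1} ∫ g h`. -/
def assocOf {n : ℕ} (N : ((Fin n → ℝ) → ℝ≥0∞) → ℝ≥0∞)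
    (g : (Fin n → ℝ) → ℝ≥0∞) : ℝ≥0∞ :=
  ⨆ (h : (Fin n → ℝ) → ℝ≥0∞) (_ : N h ≤ 1), ∫⁻ x, g x * h x

/-- The norm of the space `X^{1/p}`: `‖f‖_{X^{1/p}} = ‖|f|^p‖_X^{1/p}`. -/
def powOf {n : ℕ} (N : ((Fin n → ℝ) → ℝ≥0∞) → ℝ≥0∞) (p : ℝ)
    (f : (Fin n → ℝ) → ℝ≥0∞) : ℝ≥0∞ :=
  (N fun x => f x ^ p) ^ (1 / p)

/-- An operator `T` is bounded with respect to the function norm `N`. -/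
def BoundedOn {n : ℕ} (N : ((Fin n → ℝ) → ℝ≥0∞) → ℝ≥0∞)
    (T : ((Fin n → ℝ) → ℝ≥0∞) → (Fin n → ℝ) → ℝ≥0∞) : Prop :=
  ∃ C : ℝ, 0 < C ∧ ∀ f, N (T f) ≤ ENNReal.ofReal C * N f

/-- `X` is `p`-convex. -/
def PConvex {n : ℕ} (N : ((Fin n → ℝ) → ℝ≥0∞) → ℝ≥0∞) (p : ℝ) : Prop :=
  ∀ f g, N (fun x => (f x ^ p + g x ^ p) ^ (1 / p)) ≤ (N f ^ p + N g ^ p) ^ (1 / p)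

/-- `X` is `q`-concave. -/
def QConcave {n : ℕ} (N : ((Fin n → ℝ) → ℝ≥0∞) → ℝ≥0∞) (q : ℝ) : Prop :=
  ∀ f g, (N f ^ q + N g ^ q) ^ (1 / q) ≤ N (fun x => (f x ^ q + g x ^ q) ^ (1 / q))

end

theorem avg_le_lintegral_rearr (n : ℕ) (f : (Fin n → ℝ) → ℝ) (hf : Measurable f)
    (Q : Set (Fin n → ℝ)) (hQ : MeasurableSet Q) (h0 : volume Q ≠ 0) (h1 : volume Q ≠ ∞) :
    (∫⁻ y in Q, toE f y) / volume Q ≤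
      ∫⁻ la in Set.Ioo (0 : ℝ) 1, rearr (Q.indicator (toE f)) (ENNReal.ofReal la * volume Q) := by
  set D : ℝ → ℝ≥0∞ := fun t => volume ({y | t < |f y|} ∩ Q) with hD
  have hDanti : Antitone D := fun s t hst => measure_mono
    (inter_subset_inter_left _ fun y (hy : t < |f y|) => lt_of_le_of_lt hst hy)
  have hDm : Measurable D := hDanti.measurable
  have hDle : ∀ t, D t ≤ volume Q := fun t => measure_mono inter_subset_right
  have hlayer : ∫⁻ y in Q, toE f y = ∫⁻ t in Ioi (0 : ℝ), D t := by
    have := lintegral_eq_lintegral_meas_lt (volume.restrict Q) (f := fun y => |f y|)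
      (Eventually.of_forall fun y => abs_nonneg _) hf.abs.aemeasurable
    simp only [toE]
    rw [this]
    refine lintegral_congr fun t => ?_
    rw [Measure.restrict_apply (measurableSet_lt measurable_const hf.abs)]
  set S : Set (ℝ × ℝ) := {p | ENNReal.ofReal p.1 * volume Q < D p.2} with hS
  have hSm : MeasurableSet S :=
    measurableSet_lt (by fun_prop) (hDm.comp measurable_snd)
  -- pointwise lower bound for the rearrangement
  have hpt : ∀ la : ℝ, ∫⁻ t in Ioi (0 : ℝ), S.indicator (1 : ℝ × ℝ → ℝ≥0∞) (la, t) ≤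
      rearr (Q.indicator (toE f)) (ENNReal.ofReal la * volume Q) := by
    intro la
    refine le_sInf ?_
    rintro b ⟨hb0, hb⟩
    rcases eq_or_ne b ∞ with rfl | hbt
    · exact le_top
    have hsub : ∀ t ∈ Ioi (0 : ℝ), S.indicator (1 : ℝ × ℝ → ℝ≥0∞) (la, t) ≤
        (Ioo 0 b.toReal).indicator 1 t := by
      intro t ht
      by_cases hm : (la, t) ∈ S
      · have : t < b.toReal := by
          by_contra! hle
          refine absurd (hb.trans_lt hm) (not_lt.2 (measure_mono ?_))
          rintro y ⟨hy, hyQ⟩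
          simp only [mem_ofPred_eq, indicator_of_mem hyQ, toE]
          rw [ENNReal.lt_ofReal_iff_toReal_lt hbt]
          exact lt_of_le_of_lt hle hy
        rw [indicator_of_mem (show t ∈ Ioo 0 b.toReal from ⟨ht, this⟩)]
        exact indicator_le_self _ _ _
      · rw [indicator_of_notMem hm]; exact zero_le
    calc _ ≤ ∫⁻ t in Ioi (0 : ℝ), (Ioo 0 b.toReal).indicator 1 t :=
          setLIntegral_mono' measurableSet_Ioi hsub
      _ ≤ ∫⁻ t, (Ioo 0 b.toReal).indicator 1 t := setLIntegral_le_lintegral _ _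
      _ = b := by
        rw [lintegral_indicator_one measurableSet_Ioo, Real.volume_Ioo, sub_zero,
          ENNReal.ofReal_toReal hbt]
  refine le_trans ?_ (lintegral_mono hpt)
  rw [lintegral_lintegral_swap (f := fun la t => S.indicator (1 : ℝ × ℝ → ℝ≥0∞) (la, t))
    (measurable_one.indicator hSm).aemeasurable, hlayer,
    div_eq_mul_inv, ← lintegral_mul_const _ hDm]
  refine lintegral_mono fun t => ?_
  rw [← div_eq_mul_inv]
  have hr1 : D t / volume Q ≤ 1 := ENNReal.div_le_of_le_mul (by simpa using hDle t)
  have hrt : D t / volume Q ≠ ∞ := (hr1.trans_lt ENNReal.one_lt_top).ne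
  set r := (D t / volume Q).toReal with hr
  have hr1' : r ≤ 1 := by
    rw [← ENNReal.toReal_one]; exact ENNReal.toReal_mono ENNReal.one_ne_top hr1
  have hle : ∀ la ∈ Ioo (0 : ℝ) 1, (Ioo 0 r).indicator (1 : ℝ → ℝ≥0∞) la ≤
      S.indicator (1 : ℝ × ℝ → ℝ≥0∞) (la, t) := by
    intro la hla
    by_cases hm : la ∈ Ioo 0 r
    · have : (la, t) ∈ S := by
        have h2 : ENNReal.ofReal la < D t / volume Q := by
          rw [ENNReal.ofReal_lt_iff_lt_toReal hla.1.le hrt]; exact hm.2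
        exact (ENNReal.lt_div_iff_mul_lt (Or.inl h0) (Or.inl h1)).1 h2
      rw [indicator_of_mem hm, indicator_of_mem this]; rfl
    · rw [indicator_of_notMem hm]; exact zero_le
  calc D t / volume Q = volume (Ioo 0 r) := by
        rw [Real.volume_Ioo, sub_zero, ENNReal.ofReal_toReal hrt]
    _ = ∫⁻ la in Ioo (0 : ℝ) 1, (Ioo 0 r).indicator (1 : ℝ → ℝ≥0∞) la := by
        rw [lintegral_indicator_one measurableSet_Ioo, Measure.restrict_apply measurableSet_Ioo,
          inter_eq_left.2 (Ioo_subset_Ioo_right hr1')]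
    _ ≤ _ := setLIntegral_mono' measurableSet_Ioo hle

/-- pointwise bound `M f(x) ≤ ∫_0^1 m_λ f(x) dλ`. -/
theorem stmt7 (n : ℕ) (f : (Fin n → ℝ) → ℝ) (hf : Measurable f) (x : Fin n → ℝ) :
    maximal (toE f) x ≤ ∫⁻ la in Set.Ioo (0 : ℝ) 1, mMed la (toE f) x := by
  refine iSup_le fun Q => iSup_le fun hQ => iSup_le fun hx => ?_
  have hv : MeasurableSet Q ∧ volume Q ≠ 0 ∧ volume Q ≠ ∞ := by
    obtain ⟨a, h, hh, rfl⟩ := hQ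
    refine ⟨measurableSet_Icc, ?_, ?_⟩
    · rw [Real.volume_Icc_pi]
      simp [hh]
    · rw [Real.volume_Icc_pi]
      simp
  refine (avg_le_lintegral_rearr n f hf Q hv.1 hv.2.1 hv.2.2).trans (lintegral_mono fun la => ?_)
  exact le_iSup_of_le Q (le_iSup_of_le hQ (le_iSup_of_le hx le_rfl))
end

section
/- Let X be a Banach function space over ℝⁿ. Suppose that the λ-median maximal operator m_λ is bounded on X for some λ ∈ (0,1). Then there exists p > 1 such that the Hardy–Littlewood maximal operator M is bounded on X^{1/p}. -/
open MeasureTheory Set Filter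
open scoped ENNReal Topology

open Metric in
theorem isCube_closedBall {n : ℕ} (w : Fin n → ℝ) {r : ℝ} (hr : 0 < r) :
    IsCube (closedBall w r) := by
  refine ⟨fun i => w i - r, 2 * r, by linarith, ?_⟩
  rw [closedBall_pi _ hr.le, ← Set.pi_univ_Icc]
  congr 1
  ext i : 1
  rw [Real.closedBall_eq_Icc]
  congr 1
  ring

open Metric in
theorem IsCube.eq_closedBall {n : ℕ} {Q : Set (Fin n → ℝ)} (hQ : IsCube Q) :
    ∃ w r, 0 < r ∧ Q = closedBall w r := by
  obtain ⟨a, h, hh, rfl⟩ := hQ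
  refine ⟨fun i => a i + h / 2, h / 2, by linarith, ?_⟩
  rw [closedBall_pi _ (by linarith), ← Set.pi_univ_Icc]
  congr 1
  ext i : 1
  rw [Real.closedBall_eq_Icc]
  congr 1 <;> ring

open Metric in
theorem vol_cb {n : ℕ} (w : Fin n → ℝ) {r : ℝ} (hr : 0 ≤ r) :
    volume (closedBall w r) = ENNReal.ofReal ((2 * r) ^ n) := by
  rw [Real.volume_pi_closedBall _ hr]; simp

open Metric in
/-- selection of a good subcube around almost every point -/
theorem good_cube {n : ℕ} {la lb : ℝ} (h0 : 0 < la) (hab : la < lb) (hb : lb < 1)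
    (E F : Set (Fin n → ℝ)) (hE : MeasurableSet E) (w : Fin n → ℝ) (r : ℝ) (hr : 0 < r)
    (hF : ∀ z ρ, 0 < ρ → closedBall z ρ ⊆ closedBall w r →
      ENNReal.ofReal la * volume (closedBall z ρ) < volume (E ∩ closedBall z ρ) →
      closedBall z ρ ⊆ F)
    (hle : volume (E ∩ closedBall w r) ≤ ENNReal.ofReal la * volume (closedBall w r)) :
    ∀ᵐ x, x ∈ E ∩ closedBall w r → ∃ b : (Fin n → ℝ) × ℝ, 0 < b.2 ∧ b.2 ≤ r ∧
      x ∈ closedBall b.1 b.2 ∧ closedBall b.1 b.2 ⊆ closedBall w r ∧ closedBall b.1 b.2 ⊆ F ∧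
      volume (E ∩ closedBall b.1 b.2) ≤ ENNReal.ofReal lb * volume (closedBall b.1 b.2) := by
  obtain ⟨s, hs0, hs1, hs⟩ : ∃ s : ℝ, 0 < s ∧ s < 1 ∧ la ≤ lb * s ^ n := by
    have h1 : Tendsto (fun s : ℝ => lb * s ^ n) (𝓝[<] 1) (𝓝 (lb * 1 ^ n)) :=
      ((continuous_const.mul (continuous_pow n)).tendsto 1).mono_left nhdsWithin_le_nhds
    have h2 : ∀ᶠ s : ℝ in 𝓝[<] 1, la < lb * s ^ n :=
      h1.eventually (lt_mem_nhds (by simpa using hab))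
    have h3 : ∀ᶠ s : ℝ in 𝓝[<] 1, s ∈ Ioo (0:ℝ) 1 := Ioo_mem_nhdsLT (by norm_num)
    obtain ⟨s, ha, hb⟩ := (h2.and h3).exists
    exact ⟨s, hb.1, hb.2, ha.le⟩
  have hdens := IsUnifLocDoublingMeasure.ae_tendsto_measure_inter_div
    (volume : Measure (Fin n → ℝ)) E 1
  rw [ae_restrict_iff' hE] at hdens
  filter_upwards [hdens] with x hx hxE
  set c : ℕ → (Fin n → ℝ) := fun k => x + s ^ k • (w - x) with hc
  set d : ℕ → ℝ := fun k => s ^ k * r with hd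
  have hdpos : ∀ k, 0 < d k := fun k => by positivity
  have hxw : dist x w ≤ r := hxE.2
  have hxmem : ∀ k, x ∈ closedBall (c k) (d k) := by
    intro k
    rw [mem_closedBall, dist_eq_norm]
    have : x - c k = s ^ k • (x - w) := by
      simp only [hc]; rw [← neg_sub w x, smul_neg]; abel
    rw [this, norm_smul, ← dist_eq_norm, Real.norm_of_nonneg (by positivity)]
    exact mul_le_mul_of_nonneg_left hxw (by positivity)
  have hsub : ∀ k, closedBall (c (k+1)) (d (k+1)) ⊆ closedBall (c k) (d k) := by
    intro k
    apply closedBall_subset_closedBall'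
    have : c (k+1) - c k = (s ^ k * (1 - s)) • (x - w) := by
      simp only [hc, pow_succ]; module
    rw [dist_eq_norm, this, norm_smul, ← dist_eq_norm,
      Real.norm_of_nonneg (mul_nonneg (by positivity) (by linarith))]
    have h5 : s ^ k * (1 - s) * dist x w ≤ s ^ k * (1 - s) * r :=
      mul_le_mul_of_nonneg_left hxw (mul_nonneg (by positivity) (by linarith))
    simp only [hd, pow_succ]
    linarith
  have hanti : Antitone fun k => closedBall (c k) (d k) := antitone_nat_of_succ_le hsub
  have hz : closedBall (c 0) (d 0) = closedBall w r := by simp [hc, hd]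
  have hdlim : Tendsto d atTop (𝓝[>] 0) := by
    rw [tendsto_nhdsWithin_iff]
    refine ⟨?_, Eventually.of_forall hdpos⟩
    simpa using (tendsto_pow_atTop_nhds_zero_of_lt_one hs0.le hs1).mul_const r
  have hlim := hx hxE.1 c d hdlim (Eventually.of_forall fun k => by simpa using hxmem k)
  have hex : ∃ k, ENNReal.ofReal la * volume (closedBall (c k) (d k)) <
      volume (E ∩ closedBall (c k) (d k)) := by
    have h1 : ENNReal.ofReal la < 1 := by
      rw [ENNReal.ofReal_lt_one]; linarith
    obtain ⟨k, hk⟩ := (hlim.eventually (lt_mem_nhds h1)).exists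
    refine ⟨k, ?_⟩
    have := ENNReal.mul_lt_of_lt_div hk
    exact this
  classical
  obtain ⟨k, hk, hmin⟩ : ∃ k, (ENNReal.ofReal la * volume (closedBall (c k) (d k)) <
      volume (E ∩ closedBall (c k) (d k))) ∧ ∀ m < k, ¬ (ENNReal.ofReal la *
      volume (closedBall (c m) (d m)) < volume (E ∩ closedBall (c m) (d m))) :=
    ⟨Nat.find hex, Nat.find_spec hex, fun m hm => Nat.find_min hex hm⟩
  have hsubQ : closedBall (c k) (d k) ⊆ closedBall w r := hz ▸ hanti (Nat.zero_le k)
  obtain _ | m := k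
  · rw [hz] at hk; exact absurd hk (not_lt.2 hle)
  refine ⟨(c (m+1), d (m+1)), hdpos _, ?_, hxmem _, hsubQ, hF _ _ (hdpos _) hsubQ hk, ?_⟩
  · exact mul_le_of_le_one_left hr.le (pow_le_one₀ hs0.le hs1.le)
  · have h1 := not_lt.1 (hmin m (Nat.lt_succ_self m))
    refine (measure_mono (inter_subset_inter_right E (hsub m))).trans (h1.trans ?_)
    rw [vol_cb _ (hdpos _).le, vol_cb _ (hdpos _).le, ← ENNReal.ofReal_mul h0.le,
      ← ENNReal.ofReal_mul (by linarith)]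
    apply ENNReal.ofReal_le_ofReal
    have : (2 * d (m+1)) ^ n = s ^ n * (2 * d m) ^ n := by
      rw [← mul_pow]; simp only [hd, pow_succ]; ring
    have hdm := hdpos m
    have h7 := mul_le_mul_of_nonneg_right hs (show 0 ≤ (2 * d m) ^ n by positivity)
    rw [this]
    linarith

open Metric in
theorem expand {n : ℕ} {la lb : ℝ} (h0 : 0 < la) (hab : la < lb) (hb : lb < 1)
    (E F : Set (Fin n → ℝ)) (hE : MeasurableSet E) (w : Fin n → ℝ) (r : ℝ) (hr : 0 < r)
    (hF : ∀ z ρ, 0 < ρ → closedBall z ρ ⊆ closedBall w r →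
      ENNReal.ofReal la * volume (closedBall z ρ) < volume (E ∩ closedBall z ρ) →
      closedBall z ρ ⊆ F)
    (hle : volume (E ∩ closedBall w r) ≤ ENNReal.ofReal la * volume (closedBall w r)) :
    ENNReal.ofReal (1 + (1 - lb) * (5 ^ n)⁻¹) * volume (E ∩ closedBall w r) ≤
      volume (F ∩ closedBall w r) := by
  have hgood := good_cube h0 hab hb E F hE w r hr hF hle
  set Q := closedBall w r with hQ
  set t : Set ((Fin n → ℝ) × ℝ) := {b | 0 < b.2 ∧ b.2 ≤ r ∧
      closedBall b.1 b.2 ⊆ Q ∧ closedBall b.1 b.2 ⊆ F ∧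
      volume (E ∩ closedBall b.1 b.2) ≤ ENNReal.ofReal lb * volume (closedBall b.1 b.2)} with ht
  obtain ⟨u, hut, hdisj, hcov⟩ := Vitali.exists_disjoint_subfamily_covering_enlargement_closedBall
    t (fun b => b.1) (fun b => b.2) r (fun b hb => hb.2.1) 5 (by norm_num)
  have hu : u.Countable := hdisj.countable_of_nonempty_interior fun b hb =>
    (nonempty_ball.2 (hut hb).1).mono ball_subset_interior_closedBall
  set G := ⋃ b ∈ u, closedBall b.1 b.2 with hG
  have hGm : MeasurableSet G := MeasurableSet.biUnion hu fun b _ => measurableSet_closedBall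
  have hGF : G ⊆ F ∩ Q := iUnion₂_subset fun b hb => subset_inter (hut hb).2.2.2.1 (hut hb).2.2.1
  have hEF : volume (E ∩ Q ∪ G) ≤ volume (F ∩ Q) := by
    apply measure_mono_ae
    filter_upwards [hgood] with x hx hxx
    rcases hxx with hxx | hxx
    · obtain ⟨b, _, _, hxb, h3, h4, _⟩ := hx hxx
      exact ⟨h4 hxb, h3 hxb⟩
    · exact hGF hxx
  -- covering estimate
  have hcovest : volume (E ∩ Q) ≤ ENNReal.ofReal (5 ^ n) * ∑' b : u, volume (closedBall b.1.1 b.1.2) := by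
    calc volume (E ∩ Q) ≤ volume (⋃ b ∈ u, closedBall b.1 (5 * b.2)) := by
          apply measure_mono_ae
          filter_upwards [hgood] with x hx hxx
          obtain ⟨b, h1, h2, hxb, h3⟩ := hx hxx
          obtain ⟨b', hb', hbb⟩ := hcov b ⟨h1, h2, h3⟩
          exact mem_biUnion hb' (hbb hxb)
      _ ≤ ∑' b : u, volume (closedBall b.1.1 (5 * b.1.2)) := measure_biUnion_le _ hu _
      _ = _ := by
          rw [← ENNReal.tsum_mul_left]
          congr 1; ext b
          have := (hut b.2).1
          rw [vol_cb _ (by positivity), vol_cb _ this.le, ← ENNReal.ofReal_mul (by positivity)]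
          congr 1
          rw [← mul_pow]; ring
  have hdiff : ENNReal.ofReal (1 - lb) * ∑' b : u, volume (closedBall b.1.1 b.1.2)
      ≤ volume (G \ E) := by
    have : G \ E = ⋃ b ∈ u, (closedBall b.1 b.2 \ E) := by
      simp only [hG, iUnion_sdiff]
    rw [this, measure_biUnion hu (hdisj.mono fun b => sdiff_subset)
      (fun b _ => measurableSet_closedBall.diff hE), ← ENNReal.tsum_mul_left]
    refine ENNReal.tsum_le_tsum fun b => ?_
    have hb1 := (hut b.2).2.2.2.2
    have hfin : volume (closedBall b.1.1 b.1.2) ≠ ∞ := measure_closedBall_lt_top.ne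
    have hsum := measure_inter_add_sdiff (μ := volume) (closedBall b.1.1 b.1.2) hE
    rw [inter_comm] at hsum
    have hone : ENNReal.ofReal lb + ENNReal.ofReal (1 - lb) = 1 := by
      rw [← ENNReal.ofReal_add (by linarith) (by linarith)]; simp
    have h6 : ENNReal.ofReal lb * volume (closedBall b.1.1 b.1.2) +
        ENNReal.ofReal (1 - lb) * volume (closedBall b.1.1 b.1.2) ≤
        ENNReal.ofReal lb * volume (closedBall b.1.1 b.1.2) + volume (closedBall b.1.1 b.1.2 \ E) := by
      rw [← add_mul, hone, one_mul]
      calc _ = _ := hsum.symm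
        _ ≤ _ := by gcongr
    exact (ENNReal.add_le_add_iff_left (ENNReal.mul_ne_top ENNReal.ofReal_ne_top hfin)).1 h6
  calc ENNReal.ofReal (1 + (1 - lb) * (5 ^ n)⁻¹) * volume (E ∩ Q)
      = volume (E ∩ Q) + ENNReal.ofReal (1 - lb) * (ENNReal.ofReal (5 ^ n)⁻¹ * volume (E ∩ Q)) := by
        rw [ENNReal.ofReal_add (by norm_num) (mul_nonneg (by linarith) (by positivity)),
          ENNReal.ofReal_mul (by linarith), ENNReal.ofReal_one]
        ring
    _ ≤ volume (E ∩ Q) + ENNReal.ofReal (1 - lb) * ∑' b : u, volume (closedBall b.1.1 b.1.2) := by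
        gcongr
        calc _ ≤ ENNReal.ofReal (5 ^ n)⁻¹ * (ENNReal.ofReal (5 ^ n) * ∑' b : u, volume (closedBall b.1.1 b.1.2)) := by
              gcongr
          _ = _ := by
              rw [← mul_assoc, ← ENNReal.ofReal_mul (by positivity), inv_mul_cancel₀ (by positivity)]
              simp
    _ ≤ volume (E ∩ Q) + volume (G \ E) := by gcongr
    _ ≤ volume (E ∩ Q) + volume (G \ (E ∩ Q)) := by
        gcongr; exact inter_subset_left
    _ = volume (E ∩ Q ∪ G) := by
        rw [measure_add_sdiff (hE.inter measurableSet_closedBall).nullMeasurableSet]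
    _ ≤ _ := hEF

theorem indicator_level {n : ℕ} (f : (Fin n → ℝ) → ℝ≥0∞) (Q : Set (Fin n → ℝ)) (α : ℝ≥0∞) :
    {y | α < Q.indicator f y} = {y | α < f y} ∩ Q := by
  ext y
  by_cases hy : y ∈ Q <;> simp [hy]

theorem lt_mMed {n : ℕ} {la : ℝ} {f : (Fin n → ℝ) → ℝ≥0∞} {Q : Set (Fin n → ℝ)} (hQ : IsCube Q)
    {α : ℝ≥0∞} (h : ENNReal.ofReal la * volume Q < volume ({y | α < f y} ∩ Q)) {x} (hx : x ∈ Q) :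
    α < mMed la f x := by
  have hα : α < ∞ := by
    by_contra hcon
    have : α = ∞ := by simpa using hcon
    subst this
    simp at h
  have hrearr : rearr (Q.indicator f) (ENNReal.ofReal la * volume Q) ≤ mMed la f x :=
    le_iSup_of_le Q (le_iSup_of_le hQ (le_iSup_of_le hx le_rfl))
  refine lt_of_lt_of_le ?_ hrearr
  obtain ⟨v, hvanti, hv, hvlim⟩ := exists_seq_strictAnti_tendsto' hα
  have hU : {y | α < f y} ∩ Q = ⋃ j, ({y | v j < f y} ∩ Q) := by
    rw [← iUnion_inter]
    congr 1
    ext y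
    simp only [mem_ofPred_eq, mem_iUnion]
    constructor
    · intro hy
      exact (hvlim.eventually (gt_mem_nhds hy)).exists
    · rintro ⟨j, hj⟩
      exact (hv j).1.trans hj
  have hmono : Monotone fun j => ({y | v j < f y} ∩ Q) := by
    intro i j hij y hy
    exact ⟨(hvanti.antitone hij).trans_lt hy.1, hy.2⟩
  rw [hU, hmono.measure_iUnion, lt_iSup_iff] at h
  obtain ⟨j, hj⟩ := h
  refine (hv j).1.trans_le ?_
  refine le_sInf fun β hβ => ?_
  by_contra hcon
  push Not at hcon
  have h2 := hβ.2
  rw [indicator_level] at h2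
  refine absurd (hj.trans_le ((measure_mono ?_).trans h2)) (lt_irrefl _)
  intro y hy
  exact ⟨hcon.trans hy.1, hy.2⟩

/-- the expansion constant -/
theorem expand_mMed (n : ℕ) {la : ℝ} (h0 : 0 < la) (h1 : la < 1) :
    ∃ c : ℝ, 1 < c ∧ ∀ (f : (Fin n → ℝ) → ℝ≥0∞) (Q : Set (Fin n → ℝ)) (α : ℝ≥0∞), IsCube Q →
      volume ({y | α < f y} ∩ Q) ≤ ENNReal.ofReal la * volume Q →
      ENNReal.ofReal c * volume ({y | α < f y} ∩ Q) ≤ volume ({y | α < mMed la f y} ∩ Q) := by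
  have hlt : la < (1 + la) / 2 := by linarith
  have hlt' : (1 + la) / 2 < 1 := by linarith
  refine ⟨1 + (1 - (1 + la) / 2) * (5 ^ n)⁻¹, ?_, ?_⟩
  · have : 0 < (1 - (1 + la) / 2) * ((5:ℝ) ^ n)⁻¹ := mul_pos (by linarith) (by positivity)
    linarith
  · intro f Q α hQ hle
    obtain ⟨w, r, hr, rfl⟩ := hQ.eq_closedBall
    have key : ∀ z ρ, volume (toMeasurable volume {y | α < f y} ∩ Metric.closedBall z ρ) =
        volume ({y | α < f y} ∩ Metric.closedBall z ρ) := fun z ρ =>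
      Measure.measure_toMeasurable_inter_of_sFinite Metric.isClosed_closedBall.measurableSet _
    rw [← key] at hle ⊢
    refine expand h0 hlt hlt' _ _ (measurableSet_toMeasurable _ _) w r hr ?_ hle
    intro z ρ hρ _ hz x hx
    rw [key] at hz
    exact lt_mMed (isCube_closedBall z hρ) hz hx

theorem vol_cube_pos {n : ℕ} {Q : Set (Fin n → ℝ)} (hQ : IsCube Q) : volume Q ≠ 0 := by
  obtain ⟨w, r, hr, rfl⟩ := hQ.eq_closedBall
  exact (Metric.measure_closedBall_pos _ _ hr).ne'

theorem vol_cube_fin {n : ℕ} {Q : Set (Fin n → ℝ)} (hQ : IsCube Q) : volume Q ≠ ∞ := by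
  obtain ⟨w, r, hr, rfl⟩ := hQ.eq_closedBall
  exact measure_closedBall_lt_top.ne

theorem iterate_level {n : ℕ} {la : ℝ} (h1 : la < 1) {g : ℝ} (hg0 : 0 < g) (hg1 : g < 1)
    (hc : ∀ (f : (Fin n → ℝ) → ℝ≥0∞) (Q : Set (Fin n → ℝ)) (α : ℝ≥0∞), IsCube Q →
      volume ({y | α < f y} ∩ Q) ≤ ENNReal.ofReal la * volume Q →
      ENNReal.ofReal g⁻¹ * volume ({y | α < f y} ∩ Q) ≤ volume ({y | α < mMed la f y} ∩ Q))
    (k : ℕ) : ∀ (f : (Fin n → ℝ) → ℝ≥0∞) (Q : Set (Fin n → ℝ)) (α : ℝ≥0∞), IsCube Q →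
      ENNReal.ofReal la * ENNReal.ofReal g ^ k * volume Q < volume ({y | α < f y} ∩ Q) →
      ∀ x ∈ Q, α < (mMed la)^[k+1] f x := by
  have hgl : ENNReal.ofReal g < 1 := by rwa [ENNReal.ofReal_lt_one]
  induction k with
  | zero =>
    intro f Q α hQ h x hx
    simp only [pow_zero, mul_one] at h
    simpa using lt_mMed hQ h hx
  | succ k ih =>
    intro f Q α hQ h x hx
    rw [Function.iterate_succ_apply]
    refine ih (mMed la f) Q α hQ ?_ x hx
    rcases le_or_gt (volume ({y | α < f y} ∩ Q)) (ENNReal.ofReal la * volume Q) with hle | hlt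
    · refine lt_of_lt_of_le ?_ (hc f Q α hQ hle)
      have hgg : ENNReal.ofReal g⁻¹ * ENNReal.ofReal g = 1 := by
        rw [← ENNReal.ofReal_mul (by positivity), inv_mul_cancel₀ hg0.ne']; simp
      have hpos : ENNReal.ofReal g⁻¹ ≠ 0 := by
        simp [hg0]
      calc _ = ENNReal.ofReal g⁻¹ * (ENNReal.ofReal la * ENNReal.ofReal g ^ (k + 1) * volume Q) := by
            rw [pow_succ]
            calc _ = (ENNReal.ofReal g⁻¹ * ENNReal.ofReal g) *
                  (ENNReal.ofReal la * ENNReal.ofReal g ^ k * volume Q) := by rw [hgg, one_mul]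
              _ = _ := by ring
        _ < _ := ENNReal.mul_lt_mul_right hpos ENNReal.ofReal_ne_top h
    · have : {y | α < mMed la f y} ∩ Q = Q := inter_eq_right.2 fun y hy => lt_mMed hQ hlt hy
      rw [this]
      calc _ ≤ ENNReal.ofReal la * volume Q := by
            gcongr
            exact mul_le_of_le_one_right' (pow_le_one' hgl.le k)
        _ < 1 * volume Q := by
            refine ENNReal.mul_lt_mul_left (vol_cube_pos hQ) (vol_cube_fin hQ) ?_
            rwa [ENNReal.ofReal_lt_one]
        _ = _ := one_mul _

/-- Pointwise domination. -/
theorem avg_le {n : ℕ} {Q : Set (Fin n → ℝ)} (hQ : IsCube Q) (f : (Fin n → ℝ) → ℝ≥0∞)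
    (g : ℝ≥0∞) (hg : g < 1) (hg0 : g ≠ 0) (a : ℕ → ℝ≥0∞)
    (ha : ∀ k, volume ({y | a k < f y} ∩ Q) ≤ g ^ k * volume Q) :
    (∫⁻ y in Q, f y) / volume Q ≤ ∑' k, g⁻¹ * g ^ k * a k := by
  have hQm : MeasurableSet Q := by
    obtain ⟨w, r, hr, rfl⟩ := hQ.eq_closedBall
    exact measurableSet_closedBall
  obtain ⟨u, hu, huf, hint⟩ := exists_measurable_le_lintegral_eq (μ := volume.restrict Q) f
  have hm : ∀ k, MeasurableSet {y | a k < u y} := fun k => measurableSet_lt measurable_const hu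
  have hak : ∀ k, volume ({y | a k < u y} ∩ Q) ≤ g ^ k * volume Q := fun k =>
    (measure_mono (inter_subset_inter_left Q fun y hy => lt_of_lt_of_le hy (huf y))).trans (ha k)
  have hnull : ∀ᵐ y ∂(volume.restrict Q), ∃ k, u y ≤ a k := by
    rw [ae_iff]
    have hsub : ∀ k, volume.restrict Q {y | ¬ ∃ k, u y ≤ a k} ≤ g ^ k * volume Q := by
      intro k
      refine le_trans ?_ (hak k)
      rw [← Measure.restrict_apply (hm k)]
      refine measure_mono fun y hy => ?_
      simp only [mem_ofPred_eq, not_exists, not_le] at hy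
      exact hy k
    have hlim : Tendsto (fun k => g ^ k * volume Q) atTop (𝓝 (0 * volume Q)) :=
      ENNReal.Tendsto.mul_const (ENNReal.tendsto_pow_atTop_nhds_zero_of_lt_one hg)
        (Or.inr (vol_cube_fin hQ))
    rw [zero_mul] at hlim
    exact le_antisymm (ge_of_tendsto' hlim hsub) bot_le
  have hgt : g ≠ ∞ := (hg.trans ENNReal.one_lt_top).ne
  apply ENNReal.div_le_of_le_mul
  rw [hint]
  calc ∫⁻ y in Q, u y ≤ ∫⁻ y in Q, (a 0 + ∑' k, {y | a k < u y}.indicator (fun _ => a (k+1)) y) := by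
        apply lintegral_mono_ae
        filter_upwards [hnull] with y hy
        classical
        obtain ⟨k, hk, hmin⟩ : ∃ k, u y ≤ a k ∧ ∀ m < k, ¬ (u y ≤ a m) :=
          ⟨Nat.find hy, Nat.find_spec hy, fun m hm => Nat.find_min hy hm⟩
        obtain _ | m := k
        · exact hk.trans le_self_add
        · have h1 : a m < u y := not_le.1 (hmin m (Nat.lt_succ_self m))
          refine le_trans ?_ le_add_self
          refine le_trans ?_ (ENNReal.le_tsum m)
          rw [indicator_of_mem (by exact h1)]
          exact hk
    _ = a 0 * volume Q + ∑' k, a (k+1) * volume ({y | a k < u y} ∩ Q) := by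
        rw [lintegral_add_left measurable_const, lintegral_tsum
          (fun k => (measurable_const.indicator (hm k)).aemeasurable)]
        congr 1
        · simp
        · congr 1; ext k
          rw [lintegral_indicator_const (hm k), Measure.restrict_apply (hm k)]
    _ ≤ g⁻¹ * g ^ 0 * a 0 * volume Q + ∑' k, g⁻¹ * g ^ (k+1) * a (k+1) * volume Q := by
        refine add_le_add ?_ (ENNReal.tsum_le_tsum fun k => ?_)
        · rw [pow_zero, mul_one]
          gcongr
          exact le_mul_of_one_le_left' (ENNReal.one_le_inv.2 hg.le)
        · calc _ ≤ a (k+1) * (g ^ k * volume Q) := by gcongr; exact hak k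
            _ = _ := by
              rw [pow_succ]
              calc _ = (g⁻¹ * g) * (a (k+1) * (g ^ k * volume Q)) := by
                    rw [ENNReal.inv_mul_cancel hg0 hgt, one_mul]
                _ = _ := by ring
    _ = (∑' k, g⁻¹ * g ^ k * a k) * volume Q := by
        rw [← ENNReal.tsum_mul_right, tsum_eq_zero_add' (f := fun k => g⁻¹ * g ^ k * a k * volume Q)
          ENNReal.summable]

theorem N_zero {n : ℕ} (X : BanachFunctionSpace n) : X.N (fun _ => 0) = 0 := by
  have := X.smul_eq 0 (by simp) (fun _ => 0)
  simpa using this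

theorem N_tsum_le {n : ℕ} (X : BanachFunctionSpace n) (F : ℕ → (Fin n → ℝ) → ℝ≥0∞) :
    X.N (fun x => ∑' k, F k x) ≤ ∑' k, X.N (F k) := by
  have h1 : (fun x => ∑' k, F k x) = fun x => ⨆ j : ℕ, ∑ k ∈ Finset.range j, F k x := by
    ext x; exact ENNReal.tsum_eq_iSup_nat
  rw [h1, X.fatou (fun j x => ∑ k ∈ Finset.range j, F k x)
    (fun j => Eventually.of_forall fun x => by
      simp only [Finset.sum_range_succ]; exact le_self_add)]
  refine iSup_le fun j => ?_
  refine le_trans ?_ (ENNReal.sum_le_tsum (Finset.range j))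
  induction j with
  | zero => simp [N_zero]
  | succ j ih =>
    simp only [Finset.sum_range_succ]
    exact (X.add_le _ _).trans (by gcongr)

theorem N_iterate {n : ℕ} (X : BanachFunctionSpace n) (T : ((Fin n → ℝ) → ℝ≥0∞) → (Fin n → ℝ) → ℝ≥0∞)
    (C : ℝ≥0∞) (hT : ∀ f, X.N (T f) ≤ C * X.N f) (k : ℕ) (f) : X.N (T^[k] f) ≤ C ^ k * X.N f := by
  induction k generalizing f with
  | zero => simp
  | succ k ih =>
    rw [Function.iterate_succ_apply]
    calc _ ≤ C ^ k * X.N (T f) := ih _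
      _ ≤ C ^ k * (C * X.N f) := by gcongr; exact hT f
      _ = _ := by ring

/-- Theorem 2 of the paper: if `m_λ` is bounded on `X` for some
`λ ∈ (0,1)`, then `M` is bounded on `X^{1/p}` for some `p > 1`. -/
theorem stmt12 (n : ℕ) (X : BanachFunctionSpace n)
    (la : ℝ) (hla : la ∈ Set.Ioo (0 : ℝ) 1)
    (h : BoundedOn X.N (mMed la)) :
    ∃ p : ℝ, 1 < p ∧ BoundedOn (powOf X.N p) maximal := by
  obtain ⟨C, hC0, hC⟩ := h
  obtain ⟨c, hc1, hc⟩ := expand_mMed n hla.1 hla.2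
  have hc0 : 0 < c := by linarith
  set g : ℝ := c⁻¹ with hgdef
  have hg0 : 0 < g := inv_pos.2 hc0
  have hg1 : g < 1 := inv_lt_one_of_one_lt₀ hc1
  rw [show c = g⁻¹ by simp [hgdef]] at hc
  have hit := iterate_level hla.2 hg0 hg1 hc
  set δ := √g with hδ
  have hδ0 : 0 < δ := Real.sqrt_pos.2 hg0
  have hδ1 : δ < 1 := by rw [hδ, Real.sqrt_lt' one_pos]; simpa using hg1
  set e := ENNReal.ofReal δ with he
  have hge : ENNReal.ofReal g = e * e := by
    rw [he, ← ENNReal.ofReal_mul hδ0.le, Real.mul_self_sqrt hg0.le]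
  have hel : e < 1 := by rwa [he, ENNReal.ofReal_lt_one]
  have hgl : ENNReal.ofReal g < 1 := by rwa [ENNReal.ofReal_lt_one]
  have hgn : ENNReal.ofReal g ≠ 0 := by simp [hg0]
  obtain ⟨m, hm⟩ : ∃ m : ℕ, δ ^ m < 1 / (2 * C) := exists_pow_lt_of_lt_one (by positivity) hδ1
  set p : ℝ := ((m + 2 : ℕ) : ℝ) with hp
  have hp1 : 1 < p := by rw [hp]; norm_cast; omega
  have hp0 : 0 < p := by linarith
  have hsmall : e ^ p * ENNReal.ofReal C ≤ 2⁻¹ := by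
    rw [hp, ENNReal.rpow_natCast, he, ← ENNReal.ofReal_pow hδ0.le,
      ← ENNReal.ofReal_mul (by positivity)]
    have h2 : (2⁻¹ : ℝ≥0∞) = ENNReal.ofReal (2⁻¹) := by
      rw [ENNReal.ofReal_inv_of_pos (by norm_num)]; simp
    rw [h2]
    apply ENNReal.ofReal_le_ofReal
    have h3 : δ ^ (m+2) ≤ δ ^ m := pow_le_pow_of_le_one hδ0.le hδ1.le (by omega)
    calc δ ^ (m+2) * C ≤ 1 / (2 * C) * C := by gcongr; exact h3.trans hm.le
      _ = 2⁻¹ := by field_simp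
  set K : ℝ≥0∞ := ∑' k : ℕ, (ENNReal.ofReal g)⁻¹ * e ^ k with hK
  have hKtop : K ≠ ∞ := by
    rw [hK, ENNReal.tsum_mul_left, ENNReal.tsum_geometric]
    refine ENNReal.mul_ne_top (ENNReal.inv_ne_top.2 hgn) (ENNReal.inv_ne_top.2 ?_)
    exact (tsub_pos_of_lt hel).ne'
  have hKp : K ^ p ≠ ∞ := ENNReal.rpow_ne_top_of_nonneg hp0.le hKtop
  -- pointwise bound
  have hpt : ∀ (f : (Fin n → ℝ) → ℝ≥0∞) (x : Fin n → ℝ), maximal f x ^ p ≤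
      K ^ p * ∑' k, (e ^ p) ^ k * (mMed la)^[k+1] (fun y => f y ^ p) x := by
    intro f x
    set S := ∑' k, (e ^ p) ^ k * (mMed la)^[k+1] (fun y => f y ^ p) x with hS
    have hM : maximal f x ≤ K * S ^ (1 / p) := by
      refine iSup_le fun Q => iSup_le fun hQ => iSup_le fun hx => ?_
      refine (avg_le hQ f (ENNReal.ofReal g) hgl hgn
        (fun k => ((mMed la)^[k+1] (fun y => f y ^ p) x) ^ (1 / p)) ?_).trans ?_
      · intro k
        by_contra hcon
        push Not at hcon
        have hset : {y | ((mMed la)^[k+1] (fun y => f y ^ p) x) ^ (1 / p) < f y} =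
            {y | (mMed la)^[k+1] (fun y => f y ^ p) x < f y ^ p} := by
          ext y
          simp only [mem_ofPred_eq, one_div]
          exact ENNReal.rpow_inv_lt_iff hp0
        rw [hset] at hcon
        refine lt_irrefl _ (hit k (fun y => f y ^ p) Q _ hQ (lt_of_le_of_lt ?_ hcon) x hx)
        gcongr
        refine mul_le_of_le_one_left' ?_
        rw [ENNReal.ofReal_le_one]; exact hla.2.le
      · rw [hK, ← ENNReal.tsum_mul_right]
        refine ENNReal.tsum_le_tsum fun k => ?_
        rw [hge, mul_pow, ← mul_assoc, mul_assoc]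
        gcongr
        have h4 : (e ^ p) ^ k * (mMed la)^[k+1] (fun y => f y ^ p) x ≤ S :=
          ENNReal.le_tsum (f := fun k => (e ^ p) ^ k * (mMed la)^[k+1] (fun y => f y ^ p) x) k
        have h5 := ENNReal.rpow_le_rpow h4 (show 0 ≤ 1 / p by positivity)
        rw [ENNReal.mul_rpow_of_nonneg _ _ (by positivity), ← ENNReal.rpow_natCast,
          ← ENNReal.rpow_mul, ← ENNReal.rpow_mul] at h5
        rw [show p * ((k:ℝ) * (1 / p)) = k by field_simp, ENNReal.rpow_natCast] at h5
        exact h5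
    calc maximal f x ^ p ≤ (K * S ^ (1 / p)) ^ p := ENNReal.rpow_le_rpow hM hp0.le
      _ = K ^ p * S := by
        rw [ENNReal.mul_rpow_of_nonneg _ _ hp0.le, ← ENNReal.rpow_mul,
          one_div_mul_cancel hp0.ne', ENNReal.rpow_one]
  have hN : ∀ f : (Fin n → ℝ) → ℝ≥0∞, X.N (fun x => maximal f x ^ p) ≤
      (K ^ p * (ENNReal.ofReal C * 2)) * X.N (fun x => f x ^ p) := by
    intro f
    set φ : (Fin n → ℝ) → ℝ≥0∞ := fun y => f y ^ p with hφ
    calc X.N (fun x => maximal f x ^ p)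
        ≤ X.N (fun x => K ^ p * ∑' k, (e ^ p) ^ k * (mMed la)^[k+1] φ x) :=
          X.mono _ _ (Eventually.of_forall (hpt f))
      _ = K ^ p * X.N (fun x => ∑' k, (e ^ p) ^ k * (mMed la)^[k+1] φ x) := X.smul_eq _ hKp _
      _ ≤ K ^ p * ∑' k, X.N (fun x => (e ^ p) ^ k * (mMed la)^[k+1] φ x) := by
          gcongr
          exact N_tsum_le X (fun k x => (e ^ p) ^ k * (mMed la)^[k+1] φ x)
      _ ≤ K ^ p * ∑' k : ℕ, 2⁻¹ ^ k * (ENNReal.ofReal C * X.N φ) := by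
          gcongr with k
          rw [X.smul_eq _ (ENNReal.pow_ne_top
            (ENNReal.rpow_ne_top_of_nonneg hp0.le ENNReal.ofReal_ne_top))]
          calc _ ≤ (e ^ p) ^ k * (ENNReal.ofReal C ^ (k+1) * X.N φ) := by
                gcongr; exact N_iterate X _ _ hC _ _
            _ = (e ^ p * ENNReal.ofReal C) ^ k * (ENNReal.ofReal C * X.N φ) := by
                rw [mul_pow, pow_succ]; ring
            _ ≤ _ := by gcongr
      _ = _ := by
          rw [ENNReal.tsum_mul_right, ENNReal.tsum_geometric, ENNReal.one_sub_inv_two, inv_inv]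
          ring
  set B : ℝ≥0∞ := (K ^ p * (ENNReal.ofReal C * 2)) ^ (1 / p) with hB
  have hBtop : B ≠ ∞ := by
    refine ENNReal.rpow_ne_top_of_nonneg (by positivity) ?_
    exact ENNReal.mul_ne_top hKp (ENNReal.mul_ne_top ENNReal.ofReal_ne_top (by simp))
  refine ⟨p, hp1, B.toReal + 1, by positivity, fun f => ?_⟩
  unfold powOf
  calc _ ≤ ((K ^ p * (ENNReal.ofReal C * 2)) * X.N (fun x => f x ^ p)) ^ (1 / p) :=
        ENNReal.rpow_le_rpow (hN f) (by positivity)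
    _ = B * (X.N (fun x => f x ^ p)) ^ (1 / p) := by
        rw [ENNReal.mul_rpow_of_nonneg _ _ (by positivity)]
    _ ≤ _ := by
        gcongr
        calc B = ENNReal.ofReal B.toReal := (ENNReal.ofReal_toReal hBtop).symm
          _ ≤ _ := ENNReal.ofReal_le_ofReal (by linarith)
end
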